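/- Suppose 𝒞, 𝒜, 𝒵 are finite nonempty sets of real numbers, p satisfies Z ⊥ C | A, and there exist real numbers γ₀, γ₁, γ₂, γ₃ such that E(Y|a,z,c) = γ₀ + γ₁·z + γ₂·c + γ₃·a for all (a,z,c). Then Var_p(φ_fd) − Var_p(φ_td) = Σ_z (p(z|a⋆) − p(z|a°))²·Σ_ā γ₂²·var(C|ā)·p(ā)/p(z|ā) + γ₁²·var(Z|a⋆)·(1/p(a⋆) − Σ_c p(c)/p(a⋆|c)) + γ₁²·var(Z|a°)·(1/p(a°) − Σ_c p(c)/p(a°|c)), where var(C|ā) = Σ_c c²·p(c|ā) − (Σ_c c·p(c|ā))² with p(c|ā) = p(ā,c)/p(ā), and var(Z|ă) = Σ_z z²·p(z|ă) − (Σ_z z·p(z|ă))². -/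

import Mathlib

open Finset

noncomputable section

namespace TwoDoorPaper

/-- Indicator 1[a = b] as a real number. -/
def ind {A : Type*} [DecidableEq A] (a b : A) : ℝ := if a = b then 1 else 0

variable {C A Z Y : Type*} [Fintype C] [Fintype A] [Fintype Z] [Fintype Y]

/-- Marginal p(c). -/
def pC (p : C → A → Z → Y → ℝ) (c : C) : ℝ := ∑ a, ∑ z, ∑ y, p c a z y

/-- Marginal p(a,c). -/
def pAC (p : C → A → Z → Y → ℝ) (a : A) (c : C) : ℝ := ∑ z, ∑ y, p c a z y

/-- Marginal p(c,a,z). -/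
def pCAZ (p : C → A → Z → Y → ℝ) (c : C) (a : A) (z : Z) : ℝ := ∑ y, p c a z y

/-- Marginal p(a). -/
def pA (p : C → A → Z → Y → ℝ) (a : A) : ℝ := ∑ c, pAC p a c

/-- Marginal p(a,z). -/
def pAZ (p : C → A → Z → Y → ℝ) (a : A) (z : Z) : ℝ := ∑ c, pCAZ p c a z

/-- Marginal p(z,c). -/
def pZC (p : C → A → Z → Y → ℝ) (z : Z) (c : C) : ℝ := ∑ a, pCAZ p c a z

/-- Conditional p(a|c). -/
def cA (p : C → A → Z → Y → ℝ) (a : A) (c : C) : ℝ := pAC p a c / pC p c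

/-- Conditional p(z|a,c). -/
def cZ (p : C → A → Z → Y → ℝ) (z : Z) (a : A) (c : C) : ℝ := pCAZ p c a z / pAC p a c

/-- Conditional p(z|a). -/
def cZA (p : C → A → Z → Y → ℝ) (z : Z) (a : A) : ℝ := pAZ p a z / pA p a

/-- Conditional p(y|a,z,c). -/
def cY (p : C → A → Z → Y → ℝ) (a : A) (z : Z) (c : C) (y : Y) : ℝ := p c a z y / pCAZ p c a z

/-- Conditional p(y|a,z). -/
def cYaz (p : C → A → Z → Y → ℝ) (a : A) (z : Z) (y : Y) : ℝ := (∑ c, p c a z y) / pAZ p a z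

/-- Conditional p(y|a,c). -/
def cYac (p : C → A → Z → Y → ℝ) (a : A) (c : C) (y : Y) : ℝ := (∑ z, p c a z y) / pAC p a c

/-- Conditional p(y|z,c). -/
def cYzc (p : C → A → Z → Y → ℝ) (z : Z) (c : C) (y : Y) : ℝ := (∑ a, p c a z y) / pZC p z c

/-- Conditional expectation E(Y|a,z,c). -/
def EYazc (p : C → A → Z → Y → ℝ) (yv : Y → ℝ) (a : A) (z : Z) (c : C) : ℝ :=
  ∑ y, yv y * cY p a z c y

/-- Conditional variance var(Y|a,z,c). -/
def VYazc (p : C → A → Z → Y → ℝ) (yv : Y → ℝ) (a : A) (z : Z) (c : C) : ℝ :=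
  (∑ y, (yv y) ^ 2 * cY p a z c y) - (EYazc p yv a z c) ^ 2

/-- Conditional expectation E(Y|a,z). -/
def EYaz (p : C → A → Z → Y → ℝ) (yv : Y → ℝ) (a : A) (z : Z) : ℝ :=
  ∑ y, yv y * cYaz p a z y

/-- Conditional variance var(Y|a,z). -/
def VYaz (p : C → A → Z → Y → ℝ) (yv : Y → ℝ) (a : A) (z : Z) : ℝ :=
  (∑ y, (yv y) ^ 2 * cYaz p a z y) - (EYaz p yv a z) ^ 2

/-- Conditional expectation E(Y|a,c). -/
def EYac (p : C → A → Z → Y → ℝ) (yv : Y → ℝ) (a : A) (c : C) : ℝ :=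
  ∑ y, yv y * cYac p a c y

/-- Conditional expectation E(Y|z,c). -/
def EYzc (p : C → A → Z → Y → ℝ) (yv : Y → ℝ) (z : Z) (c : C) : ℝ :=
  ∑ y, yv y * cYzc p z c y

/-- Conditional variance var(Y|z,c). -/
def VYzc (p : C → A → Z → Y → ℝ) (yv : Y → ℝ) (z : Z) (c : C) : ℝ :=
  (∑ y, (yv y) ^ 2 * cYzc p z c y) - (EYzc p yv z c) ^ 2

/-- var(C|a) for real-valued covariates. -/
def VCgivenA (p : C → A → Z → Y → ℝ) (cv : C → ℝ) (a : A) : ℝ :=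
  (∑ c, (cv c) ^ 2 * (pAC p a c / pA p a)) - (∑ c, cv c * (pAC p a c / pA p a)) ^ 2

/-- var(Z|a) for real-valued mediators. -/
def VZgivenA (p : C → A → Z → Y → ℝ) (zv : Z → ℝ) (a : A) : ℝ :=
  (∑ z, (zv z) ^ 2 * cZA p z a) - (∑ z, zv z * cZA p z a) ^ 2

/-- Expectation of f under p. -/
def Ep (p : C → A → Z → Y → ℝ) (f : C → A → Z → Y → ℝ) : ℝ :=
  ∑ c, ∑ a, ∑ z, ∑ y, p c a z y * f c a z y

/-- Variance of f under p. -/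
def Varp (p : C → A → Z → Y → ℝ) (f : C → A → Z → Y → ℝ) : ℝ :=
  (∑ c, ∑ a, ∑ z, ∑ y, p c a z y * (f c a z y) ^ 2) - (Ep p f) ^ 2

/-- p is a strictly positive probability mass function. -/
def IsPMF (p : C → A → Z → Y → ℝ) : Prop :=
  (∀ c a z y, 0 < p c a z y) ∧ (∑ c, ∑ a, ∑ z, ∑ y, p c a z y) = 1

/-- Y ⊥ A | (Z, C): p(y|a,z,c) does not depend on a. -/
def IndepYA (p : C → A → Z → Y → ℝ) : Prop :=
  ∀ a a' z c y, cY p a z c y = cY p a' z c y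

/-- Z ⊥ C | A: p(z|a,c) = p(z|a) for all c. -/
def IndepZC (p : C → A → Z → Y → ℝ) : Prop :=
  ∀ z a c, cZ p z a c = cZA p z a

/-- θ_td. -/
def thTD (p : C → A → Z → Y → ℝ) (yv : Y → ℝ) (astar acirc : A) : ℝ :=
  ∑ z, ∑ c, ∑ ab, EYazc p yv ab z c * (cZ p z astar c - cZ p z acirc c) * cA p ab c * pC p c

/-- The two-door efficient influence function φ_td. -/
def phiTD [DecidableEq A] (p : C → A → Z → Y → ℝ) (yv : Y → ℝ) (astar acirc : A)
    (c : C) (a : A) (z : Z) (y : Y) : ℝ :=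
  (yv y - EYazc p yv a z c) * (cZ p z astar c - cZ p z acirc c) / cZ p z a c
  + ((∑ ab, EYazc p yv ab z c * cA p ab c)
      - ∑ ab, ∑ z', EYazc p yv ab z' c * cZ p z' a c * cA p ab c)
    * (ind a astar - ind a acirc) / cA p a c
  + (∑ z', EYazc p yv a z' c * (cZ p z' astar c - cZ p z' acirc c))
  - thTD p yv astar acirc

/-- θ_bd. -/
def thBD (p : C → A → Z → Y → ℝ) (yv : Y → ℝ) (astar acirc : A) : ℝ :=
  ∑ c, pC p c * (EYac p yv astar c - EYac p yv acirc c)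

/-- The back-door efficient influence function φ_bd. -/
def phiBD [DecidableEq A] (p : C → A → Z → Y → ℝ) (yv : Y → ℝ) (astar acirc : A)
    (c : C) (a : A) (_z : Z) (y : Y) : ℝ :=
  ind a astar * (yv y - EYac p yv astar c) / cA p astar c
  - ind a acirc * (yv y - EYac p yv acirc c) / cA p acirc c
  + EYac p yv astar c - EYac p yv acirc c - thBD p yv astar acirc

/-- θ° (for the combined back-door/two-door model). -/
def thBDTD (p : C → A → Z → Y → ℝ) (yv : Y → ℝ) (astar acirc : A) : ℝ :=
  ∑ z, ∑ c, EYzc p yv z c * (cZ p z astar c - cZ p z acirc c) * pC p c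

/-- The efficient influence function φ_bdtd. -/
def phiBDTD [DecidableEq A] (p : C → A → Z → Y → ℝ) (yv : Y → ℝ) (astar acirc : A)
    (c : C) (a : A) (z : Z) (y : Y) : ℝ :=
  (yv y - EYzc p yv z c) * (cZ p z astar c - cZ p z acirc c) / (∑ ab, cZ p z ab c * cA p ab c)
  + (EYzc p yv z c - ∑ z', EYzc p yv z' c * cZ p z' a c)
    * (ind a astar - ind a acirc) / cA p a c
  + (∑ z', EYzc p yv z' c * (cZ p z' astar c - cZ p z' acirc c))
  - thBDTD p yv astar acirc

/-- ψ_fd(ă). -/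
def psiFD (p : C → A → Z → Y → ℝ) (yv : Y → ℝ) (abreve : A) : ℝ :=
  ∑ z, ∑ ab, EYaz p yv ab z * pA p ab * cZA p z abreve

/-- θ_fd. -/
def thFD (p : C → A → Z → Y → ℝ) (yv : Y → ℝ) (astar acirc : A) : ℝ :=
  psiFD p yv astar - psiFD p yv acirc

/-- The front-door efficient influence function φ_fd. -/
def phiFD [DecidableEq A] (p : C → A → Z → Y → ℝ) (yv : Y → ℝ) (astar acirc : A)
    (_c : C) (a : A) (z : Z) (y : Y) : ℝ :=
  (yv y - EYaz p yv a z) * (cZA p z astar - cZA p z acirc) / cZA p z a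
  + ind a astar * ((∑ ab, EYaz p yv ab z * pA p ab) - psiFD p yv astar) / pA p astar
  - ind a acirc * ((∑ ab, EYaz p yv ab z * pA p ab) - psiFD p yv acirc) / pA p acirc
  + (∑ z', EYaz p yv a z' * (cZA p z' astar - cZA p z' acirc))
  - thFD p yv astar acirc

/-- θ' (for the combined front-door/two-door model). -/
def thFDTD (p : C → A → Z → Y → ℝ) (yv : Y → ℝ) (astar acirc : A) : ℝ :=
  ∑ c, ∑ ab, ∑ z, EYazc p yv ab z c * (cZA p z astar - cZA p z acirc) * cA p ab c * pC p c

/-- The efficient influence function φ_fdtd. -/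
def phiFDTD [DecidableEq A] (p : C → A → Z → Y → ℝ) (yv : Y → ℝ) (astar acirc : A)
    (c : C) (a : A) (z : Z) (y : Y) : ℝ :=
  (yv y - EYazc p yv a z c) * (cZA p z astar - cZA p z acirc) / cZA p z a
  + (∑ c', ((∑ ab, EYazc p yv ab z c' * cA p ab c')
        - ∑ ab, ∑ z', EYazc p yv ab z' c' * cZA p z' a * cA p ab c') * pC p c')
    * (ind a astar - ind a acirc) / pA p a
  + (∑ z', EYazc p yv a z' c * (cZA p z' astar - cZA p z' acirc))
  - thFDTD p yv astar acirc

/-- θ'' (for the combined back/front/two-door model). -/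
def thBDFDTD (p : C → A → Z → Y → ℝ) (yv : Y → ℝ) (astar acirc : A) : ℝ :=
  ∑ c, ∑ z, EYzc p yv z c * (cZA p z astar - cZA p z acirc) * pC p c

/-- The efficient influence function φ_bdfdtd. -/
def phiBDFDTD [DecidableEq A] (p : C → A → Z → Y → ℝ) (yv : Y → ℝ) (astar acirc : A)
    (c : C) (a : A) (z : Z) (y : Y) : ℝ :=
  (yv y - EYzc p yv z c) * (cZA p z astar - cZA p z acirc) / (∑ ab, cA p ab c * cZA p z ab)
  + (∑ c', (EYzc p yv z c' - ∑ z', EYzc p yv z' c' * cZA p z' a) * pC p c')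
    * (ind a astar - ind a acirc) / (∑ c', pC p c' * cA p a c')
  + (∑ z', EYzc p yv z' c * (cZA p z' astar - cZA p z' acirc))
  - thBDFDTD p yv astar acirc


theorem IsPMF.pCAZ_pos [Nonempty Y] {p : C → A → Z → Y → ℝ} (hp : IsPMF p) (c : C) (a : A) (z : Z) :
    0 < pCAZ p c a z :=
  Finset.sum_pos (fun y _ => hp.1 c a z y) Finset.univ_nonempty

theorem IsPMF.pAC_pos [Nonempty Y] [Nonempty Z] {p : C → A → Z → Y → ℝ} (hp : IsPMF p)
    (a : A) (c : C) : 0 < pAC p a c :=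
  Finset.sum_pos (fun z _ => hp.pCAZ_pos c a z) Finset.univ_nonempty

theorem IsPMF.pC_pos [Nonempty Y] [Nonempty Z] [Nonempty A] {p : C → A → Z → Y → ℝ}
    (hp : IsPMF p) (c : C) : 0 < pC p c :=
  Finset.sum_pos (fun a _ => hp.pAC_pos a c) Finset.univ_nonempty

theorem IsPMF.pA_pos [Nonempty Y] [Nonempty Z] [Nonempty C] {p : C → A → Z → Y → ℝ}
    (hp : IsPMF p) (a : A) : 0 < pA p a :=
  Finset.sum_pos (fun c _ => hp.pAC_pos a c) Finset.univ_nonempty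

theorem IsPMF.pAZ_pos [Nonempty Y] [Nonempty C] {p : C → A → Z → Y → ℝ}
    (hp : IsPMF p) (a : A) (z : Z) : 0 < pAZ p a z :=
  Finset.sum_pos (fun c _ => hp.pCAZ_pos c a z) Finset.univ_nonempty

theorem IsPMF.cZA_pos [Nonempty Y] [Nonempty Z] [Nonempty C] {p : C → A → Z → Y → ℝ}
    (hp : IsPMF p) (z : Z) (a : A) : 0 < cZA p z a :=
  div_pos (hp.pAZ_pos a z) (hp.pA_pos a)

theorem IsPMF.cA_pos [Nonempty Y] [Nonempty Z] [Nonempty A] {p : C → A → Z → Y → ℝ}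
    (hp : IsPMF p) (a : A) (c : C) : 0 < cA p a c :=
  div_pos (hp.pAC_pos a c) (hp.pC_pos c)

theorem IsPMF.sum_pC {p : C → A → Z → Y → ℝ} (hp : IsPMF p) : ∑ c, pC p c = 1 := hp.2

theorem IsPMF.sum_pA {p : C → A → Z → Y → ℝ} (hp : IsPMF p) : ∑ a, pA p a = 1 := by
  rw [← hp.2]
  exact Finset.sum_comm

theorem IsPMF.sum_cA [Nonempty Y] [Nonempty Z] [Nonempty A] {p : C → A → Z → Y → ℝ}
    (hp : IsPMF p) (c : C) : ∑ a, cA p a c = 1 := by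
  simp only [cA, ← Finset.sum_div]
  exact div_self (hp.pC_pos c).ne'

theorem IsPMF.sum_cZA [Nonempty Y] [Nonempty Z] [Nonempty C] {p : C → A → Z → Y → ℝ}
    (hp : IsPMF p) (a : A) : ∑ z, cZA p z a = 1 := by
  simp only [cZA, ← Finset.sum_div]
  rw [div_eq_one_iff_eq (hp.pA_pos a).ne']
  exact Finset.sum_comm

theorem IndepZC.pCAZ_eq [Nonempty Y] [Nonempty Z] {p : C → A → Z → Y → ℝ} (hp : IsPMF p)
    (h : IndepZC p) (c : C) (a : A) (z : Z) : pCAZ p c a z = pAC p a c * cZA p z a := by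
  rw [← h z a c, cZ, mul_div_cancel₀ _ (hp.pAC_pos a c).ne']

theorem IsPMF.sum_mul_outcome [Nonempty Y] {p : C → A → Z → Y → ℝ} (hp : IsPMF p) (yv : Y → ℝ)
    (c : C) (a : A) (z : Z) : ∑ y, p c a z y * yv y = pCAZ p c a z * EYazc p yv a z c := by
  have := (hp.pCAZ_pos c a z).ne'
  rw [EYazc, Finset.mul_sum]
  refine Finset.sum_congr rfl fun y _ => ?_
  rw [cY]
  field_simp

theorem IsPMF.sum_mul_residual [Nonempty Y] {p : C → A → Z → Y → ℝ} (hp : IsPMF p) (yv : Y → ℝ)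
    (c : C) (a : A) (z : Z) : ∑ y, p c a z y * (yv y - EYazc p yv a z c) = 0 := by
  simp only [mul_sub, Finset.sum_sub_distrib]
  rw [hp.sum_mul_outcome, ← Finset.sum_mul, sub_eq_zero]
  rfl

/-- The outcome residual is uncorrelated with any function of `(c, a, z)`. -/
theorem IsPMF.Varp_residual_add [Nonempty Y] {p : C → A → Z → Y → ℝ} (hp : IsPMF p) (yv : Y → ℝ)
    (K : A → Z → ℝ) (G : C → A → Z → ℝ) (hG : ∑ c, ∑ a, ∑ z, pCAZ p c a z * G c a z = 0) :
    Varp p (fun c a z y => (yv y - EYazc p yv a z c) * K a z + G c a z) =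
      (∑ c, ∑ a, ∑ z, ∑ y, p c a z y * ((yv y - EYazc p yv a z c) * K a z) ^ 2)
        + ∑ c, ∑ a, ∑ z, pCAZ p c a z * G c a z ^ 2 := by
  have hmean : Ep p (fun c a z y => (yv y - EYazc p yv a z c) * K a z + G c a z) = 0 := by
    rw [Ep, ← hG]
    refine Finset.sum_congr rfl fun c _ => Finset.sum_congr rfl fun a _ =>
      Finset.sum_congr rfl fun z _ => ?_
    simp only [mul_add, Finset.sum_add_distrib, ← mul_assoc, ← Finset.sum_mul,
      hp.sum_mul_residual]
    simp [pCAZ]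
  rw [Varp, hmean]
  simp only [← Finset.sum_add_distrib, ne_eq, OfNat.ofNat_ne_zero, not_false_eq_true, zero_pow,
    sub_zero]
  refine Finset.sum_congr rfl fun c _ => Finset.sum_congr rfl fun a _ =>
    Finset.sum_congr rfl fun z _ => ?_
  have hcross := hp.sum_mul_residual yv c a z
  calc ∑ y, p c a z y * ((yv y - EYazc p yv a z c) * K a z + G c a z) ^ 2
      = ∑ y, (p c a z y * ((yv y - EYazc p yv a z c) * K a z) ^ 2 + p c a z y * G c a z ^ 2
          + p c a z y * (yv y - EYazc p yv a z c) * (2 * K a z * G c a z)) :=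
        Finset.sum_congr rfl fun y _ => by ring
    _ = _ := by
        rw [Finset.sum_add_distrib, Finset.sum_add_distrib, ← Finset.sum_mul, ← Finset.sum_mul,
          hcross, zero_mul, add_zero]
        rfl

/-- The conditional mean E(C|a) of real-valued covariates. -/
def meanC (p : C → A → Z → Y → ℝ) (cv : C → ℝ) (a : A) : ℝ := ∑ c, cv c * (pAC p a c / pA p a)

/-- The conditional mean E(Z|a) of real-valued mediators. -/
def meanZ (p : C → A → Z → Y → ℝ) (zv : Z → ℝ) (a : A) : ℝ := ∑ z, zv z * cZA p z a

section Moments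

variable [Nonempty C] [Nonempty Z] [Nonempty Y] {p : C → A → Z → Y → ℝ}

theorem IsPMF.sum_cv_pAC (hp : IsPMF p) (cv : C → ℝ) (a : A) :
    ∑ c, pAC p a c * cv c = pA p a * meanC p cv a := by
  have := (hp.pA_pos a).ne'
  rw [meanC, Finset.mul_sum]
  refine Finset.sum_congr rfl fun c _ => ?_
  field_simp

theorem IsPMF.sum_pAC_centered (hp : IsPMF p) (cv : C → ℝ) (a : A) :
    ∑ c, pAC p a c * (cv c - meanC p cv a) = 0 := by
  simp only [mul_sub, Finset.sum_sub_distrib]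
  rw [hp.sum_cv_pAC, ← Finset.sum_mul, sub_eq_zero]
  rfl

theorem IsPMF.sum_pAC_centered_sq (hp : IsPMF p) (cv : C → ℝ) (a : A) :
    ∑ c, pAC p a c * (cv c - meanC p cv a) ^ 2 = pA p a * VCgivenA p cv a := by
  have hpa := (hp.pA_pos a).ne'
  have hsq : ∑ c, pAC p a c * cv c ^ 2 = pA p a * ∑ c, cv c ^ 2 * (pAC p a c / pA p a) := by
    rw [Finset.mul_sum]
    refine Finset.sum_congr rfl fun c _ => ?_
    field_simp
  have hsum : ∑ c, pAC p a c = pA p a := rfl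
  calc ∑ c, pAC p a c * (cv c - meanC p cv a) ^ 2
      = ∑ c, (pAC p a c * cv c ^ 2 - pAC p a c * cv c * (2 * meanC p cv a)
          + pAC p a c * meanC p cv a ^ 2) := Finset.sum_congr rfl fun c _ => by ring
    _ = pA p a * VCgivenA p cv a := by
        rw [Finset.sum_add_distrib, Finset.sum_sub_distrib, ← Finset.sum_mul, ← Finset.sum_mul,
          hsq, hp.sum_cv_pAC, hsum, VCgivenA]
        unfold meanC
        ring

theorem IsPMF.sum_cZA_centered (hp : IsPMF p) (zv : Z → ℝ) (a : A) :
    ∑ z, cZA p z a * (zv z - meanZ p zv a) = 0 := by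
  simp only [mul_sub, Finset.sum_sub_distrib, ← Finset.sum_mul, hp.sum_cZA, meanZ, one_mul]
  rw [sub_eq_zero]
  exact Finset.sum_congr rfl fun z _ => mul_comm _ _

theorem IsPMF.sum_cZA_centered_sq (hp : IsPMF p) (zv : Z → ℝ) (a : A) :
    ∑ z, cZA p z a * (zv z - meanZ p zv a) ^ 2 = VZgivenA p zv a := by
  calc ∑ z, cZA p z a * (zv z - meanZ p zv a) ^ 2
      = ∑ z, (zv z ^ 2 * cZA p z a - zv z * cZA p z a * (2 * meanZ p zv a)
          + cZA p z a * meanZ p zv a ^ 2) := Finset.sum_congr rfl fun z _ => by ring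
    _ = VZgivenA p zv a := by
        rw [Finset.sum_add_distrib, Finset.sum_sub_distrib, ← Finset.sum_mul, ← Finset.sum_mul,
          hp.sum_cZA, VZgivenA]
        unfold meanZ
        ring

/-- Given `Z ⊥ C | A`, a mediator term centered within each treatment arm has mean zero. -/
theorem IndepZC.sum_centered_Z (hp : IsPMF p) (h : IndepZC p) (zv : Z → ℝ) (r : A → C → ℝ) :
    ∑ c, ∑ a, ∑ z, pCAZ p c a z * ((zv z - meanZ p zv a) * r a c) = 0 := by
  refine Finset.sum_eq_zero fun c _ => Finset.sum_eq_zero fun a _ => ?_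
  calc ∑ z, pCAZ p c a z * ((zv z - meanZ p zv a) * r a c)
      = (pAC p a c * r a c) * ∑ z, cZA p z a * (zv z - meanZ p zv a) := by
        rw [Finset.mul_sum]
        refine Finset.sum_congr rfl fun z _ => ?_
        rw [h.pCAZ_eq hp]
        ring
    _ = 0 := by rw [hp.sum_cZA_centered, mul_zero]

theorem IndepZC.sum_centered_Z_sq (hp : IsPMF p) (h : IndepZC p) (zv : Z → ℝ) (r : A → C → ℝ) :
    ∑ c, ∑ a, ∑ z, pCAZ p c a z * ((zv z - meanZ p zv a) * r a c) ^ 2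
      = ∑ a, VZgivenA p zv a * ∑ c, pAC p a c * r a c ^ 2 := by
  rw [Finset.sum_comm]
  refine Finset.sum_congr rfl fun a _ => ?_
  rw [Finset.mul_sum]
  refine Finset.sum_congr rfl fun c _ => ?_
  rw [← hp.sum_cZA_centered_sq, Finset.sum_mul]
  refine Finset.sum_congr rfl fun z _ => ?_
  rw [h.pCAZ_eq hp]
  ring

theorem IndepZC.sum_centered_C (hp : IsPMF p) (h : IndepZC p) (cv : C → ℝ) (k : A → Z → ℝ) :
    ∑ c, ∑ a, ∑ z, pCAZ p c a z * ((cv c - meanC p cv a) * k a z) = 0 := by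
  rw [Finset.sum_comm]
  refine Finset.sum_eq_zero fun a _ => ?_
  rw [Finset.sum_comm]
  refine Finset.sum_eq_zero fun z _ => ?_
  calc ∑ c, pCAZ p c a z * ((cv c - meanC p cv a) * k a z)
      = (cZA p z a * k a z) * ∑ c, pAC p a c * (cv c - meanC p cv a) := by
        rw [Finset.mul_sum]
        refine Finset.sum_congr rfl fun c _ => ?_
        rw [h.pCAZ_eq hp]
        ring
    _ = 0 := by rw [hp.sum_pAC_centered, mul_zero]

theorem IndepZC.sum_centered_C_sq (hp : IsPMF p) (h : IndepZC p) (cv : C → ℝ) (k : A → Z → ℝ) :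
    ∑ c, ∑ a, ∑ z, pCAZ p c a z * ((cv c - meanC p cv a) * k a z) ^ 2
      = ∑ z, ∑ a, pA p a * VCgivenA p cv a * (cZA p z a * k a z ^ 2) := by
  rw [Finset.sum_comm]
  rw [Finset.sum_comm (s := (Finset.univ : Finset Z))]
  refine Finset.sum_congr rfl fun a _ => ?_
  rw [Finset.sum_comm]
  refine Finset.sum_congr rfl fun z _ => ?_
  rw [← hp.sum_pAC_centered_sq, Finset.sum_mul]
  refine Finset.sum_congr rfl fun c _ => ?_
  rw [h.pCAZ_eq hp]
  ring

theorem IndepZC.EYaz_eq (hp : IsPMF p) (h : IndepZC p) (yv : Y → ℝ) (a : A) (z : Z) :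
    EYaz p yv a z = ∑ c, EYazc p yv a z c * (pAC p a c / pA p a) := by
  have hpa := (hp.pA_pos a).ne'
  have hq := (hp.cZA_pos z a).ne'
  have hpaz : pAZ p a z = pA p a * cZA p z a := by
    rw [cZA, mul_div_cancel₀ _ hpa]
  calc EYaz p yv a z = (∑ y, ∑ c, p c a z y * yv y) / pAZ p a z := by
        rw [EYaz, Finset.sum_div]
        refine Finset.sum_congr rfl fun y _ => ?_
        rw [cYaz, ← Finset.sum_mul]
        ring
    _ = _ := by
        rw [Finset.sum_comm, Finset.sum_div]
        refine Finset.sum_congr rfl fun c _ => ?_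
        rw [hp.sum_mul_outcome, h.pCAZ_eq hp, hpaz]
        field_simp

theorem IndepZC.EYaz_linear {yv : Y → ℝ} {cv : C → ℝ} {av : A → ℝ} {zv : Z → ℝ}
    {γ₀ γ₁ γ₂ γ₃ : ℝ} (hp : IsPMF p) (h : IndepZC p)
    (hlin : ∀ a z c, EYazc p yv a z c = γ₀ + γ₁ * zv z + γ₂ * cv c + γ₃ * av a) (a : A) (z : Z) :
    EYaz p yv a z = γ₀ + γ₁ * zv z + γ₂ * meanC p cv a + γ₃ * av a := by
  have hone : ∑ c, pAC p a c / pA p a = 1 := by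
    rw [← Finset.sum_div]
    exact div_self (hp.pA_pos a).ne'
  calc EYaz p yv a z
      = ∑ c, ((γ₀ + γ₁ * zv z + γ₃ * av a) * (pAC p a c / pA p a)
          + γ₂ * (cv c * (pAC p a c / pA p a))) := by
        rw [h.EYaz_eq hp]
        refine Finset.sum_congr rfl fun c _ => ?_
        rw [hlin]
        ring
    _ = _ := by
        rw [Finset.sum_add_distrib, ← Finset.mul_sum, ← Finset.mul_sum, hone, ← meanC]
        ring

theorem IsPMF.sum_affine_mul_cZA (hp : IsPMF p) (zv : Z → ℝ) (k γ : ℝ) (a : A) :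
    ∑ z, (k + γ * zv z) * cZA p z a = k + γ * meanZ p zv a := by
  simp only [add_mul, Finset.sum_add_distrib, ← Finset.mul_sum, hp.sum_cZA, mul_assoc, meanZ,
    mul_one]

theorem IsPMF.sum_affine_mul_cZA_sub (hp : IsPMF p) (zv : Z → ℝ) (k γ : ℝ) (a a' : A) :
    ∑ z, (k + γ * zv z) * (cZA p z a - cZA p z a') = γ * (meanZ p zv a - meanZ p zv a') := by
  simp only [mul_sub, Finset.sum_sub_distrib, hp.sum_affine_mul_cZA]
  ring

end Moments

theorem sum_mul_ind_sub_sq [DecidableEq A] {astar acirc : A} (hne : astar ≠ acirc) (f : A → ℝ) :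
    ∑ a, f a * (ind a astar - ind a acirc) ^ 2 = f astar + f acirc := by
  have hsq : ∀ a, f a * (ind a astar - ind a acirc) ^ 2
      = (if a = astar then f a else 0) + (if a = acirc then f a else 0) := fun a => by
    by_cases h₁ : a = astar
    · simp [ind, h₁, hne]
    · by_cases h₂ : a = acirc <;> simp [ind, h₁, h₂, hne.symm]
  simp only [hsq, Finset.sum_add_distrib, Finset.sum_ite_eq', Finset.mem_univ, if_true]

section Linear

variable [Nonempty C] [Nonempty Z] [Nonempty Y] [DecidableEq A]
  {p : C → A → Z → Y → ℝ} {yv : Y → ℝ} {cv : C → ℝ} {av : A → ℝ} {zv : Z → ℝ}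
  {γ₀ γ₁ γ₂ γ₃ : ℝ}

theorem IndepZC.phiTD_linear [Nonempty A] (hp : IsPMF p) (h : IndepZC p)
    (hlin : ∀ a z c, EYazc p yv a z c = γ₀ + γ₁ * zv z + γ₂ * cv c + γ₃ * av a)
    (astar acirc : A) :
    phiTD p yv astar acirc = fun c a z y =>
      (yv y - EYazc p yv a z c) * ((cZA p z astar - cZA p z acirc) / cZA p z a)
        + (zv z - meanZ p zv a) * (γ₁ * (ind a astar - ind a acirc) / cA p a c) := by
  have hcz : ∀ z a c, cZ p z a c = cZA p z a := h
  have hcontrast : ∀ a c, ∑ z, EYazc p yv a z c * (cZA p z astar - cZA p z acirc)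
      = γ₁ * (meanZ p zv astar - meanZ p zv acirc) := fun a c => by
    rw [← hp.sum_affine_mul_cZA_sub zv (γ₀ + γ₂ * cv c + γ₃ * av a)]
    refine Finset.sum_congr rfl fun z _ => ?_
    rw [hlin]
    ring
  have hth : thTD p yv astar acirc = γ₁ * (meanZ p zv astar - meanZ p zv acirc) := by
    simp only [thTD, hcz]
    rw [Finset.sum_comm]
    calc ∑ c, ∑ z, ∑ ab, EYazc p yv ab z c * (cZA p z astar - cZA p z acirc) * cA p ab c * pC p c
        = ∑ c, (∑ ab, cA p ab c) * (γ₁ * (meanZ p zv astar - meanZ p zv acirc)) * pC p c := by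
          refine Finset.sum_congr rfl fun c _ => ?_
          rw [Finset.sum_comm, Finset.sum_mul, Finset.sum_mul]
          refine Finset.sum_congr rfl fun ab _ => ?_
          rw [← hcontrast ab c, ← Finset.sum_mul, ← Finset.sum_mul]
          ring
      _ = _ := by
          simp only [hp.sum_cA, one_mul, ← Finset.mul_sum, hp.sum_pC, mul_one]
  have hcenter : ∀ c a z, (∑ ab, EYazc p yv ab z c * cA p ab c)
      - ∑ ab, ∑ z', EYazc p yv ab z' c * cZA p z' a * cA p ab c
      = γ₁ * (zv z - meanZ p zv a) := fun c a z => by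
    calc _ = ∑ ab, γ₁ * (zv z - meanZ p zv a) * cA p ab c := by
          rw [← Finset.sum_sub_distrib]
          refine Finset.sum_congr rfl fun ab _ => ?_
          have := hp.sum_affine_mul_cZA zv (γ₀ + γ₂ * cv c + γ₃ * av ab) γ₁ a
          have hsum : ∑ z', EYazc p yv ab z' c * cZA p z' a
              = γ₀ + γ₂ * cv c + γ₃ * av ab + γ₁ * meanZ p zv a := by
            rw [← this]
            refine Finset.sum_congr rfl fun z' _ => ?_
            rw [hlin]
            ring
          rw [← Finset.sum_mul, hsum, hlin]
          ring
      _ = _ := by rw [← Finset.mul_sum, hp.sum_cA, mul_one]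
  funext c a z y
  simp only [phiTD, hcz, hcenter, hcontrast, hth]
  ring

theorem IndepZC.phiFD_linear (hp : IsPMF p) (h : IndepZC p)
    (hlin : ∀ a z c, EYazc p yv a z c = γ₀ + γ₁ * zv z + γ₂ * cv c + γ₃ * av a)
    (astar acirc : A) :
    phiFD p yv astar acirc = fun c a z y =>
      (yv y - EYazc p yv a z c) * ((cZA p z astar - cZA p z acirc) / cZA p z a)
        + ((cv c - meanC p cv a) * (γ₂ * ((cZA p z astar - cZA p z acirc) / cZA p z a))
          + (zv z - meanZ p zv a) * (γ₁ * (ind a astar - ind a acirc) / pA p a)) := by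
  have hE := h.EYaz_linear hp hlin
  have hcontrast : ∀ a, ∑ z, EYaz p yv a z * (cZA p z astar - cZA p z acirc)
      = γ₁ * (meanZ p zv astar - meanZ p zv acirc) := fun a => by
    rw [← hp.sum_affine_mul_cZA_sub zv (γ₀ + γ₂ * meanC p cv a + γ₃ * av a)]
    refine Finset.sum_congr rfl fun z _ => ?_
    rw [hE]
    ring
  obtain ⟨κ, hκ⟩ : ∃ κ, ∀ z, ∑ ab, EYaz p yv ab z * pA p ab = κ + γ₁ * zv z := by
    refine ⟨∑ ab, (γ₀ + γ₂ * meanC p cv ab + γ₃ * av ab) * pA p ab, fun z => ?_⟩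
    rw [← mul_one (γ₁ * zv z), ← hp.sum_pA, Finset.mul_sum, ← Finset.sum_add_distrib]
    refine Finset.sum_congr rfl fun ab _ => ?_
    rw [hE]
    ring
  have hpsi : ∀ a, psiFD p yv a = κ + γ₁ * meanZ p zv a := fun a => by
    simp only [psiFD, ← Finset.sum_mul, hκ, hp.sum_affine_mul_cZA]
  have hind : ∀ (a b : A) (z : Z), ind a b * (κ + γ₁ * zv z - (κ + γ₁ * meanZ p zv b)) / pA p b
      = (zv z - meanZ p zv a) * (γ₁ * ind a b / pA p a) := fun a b z => by
    by_cases hab : a = b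
    · subst hab
      ring
    · simp [ind, hab]
  funext c a z y
  simp only [phiFD, hκ, hpsi, hcontrast, hind, thFD]
  rw [hE, hlin]
  ring

theorem IndepZC.Varp_phiTD_linear [Nonempty A] (hp : IsPMF p) (h : IndepZC p)
    (hlin : ∀ a z c, EYazc p yv a z c = γ₀ + γ₁ * zv z + γ₂ * cv c + γ₃ * av a)
    {astar acirc : A} (hne : astar ≠ acirc) :
    Varp p (phiTD p yv astar acirc) =
      (∑ c, ∑ a, ∑ z, ∑ y, p c a z y *
        ((yv y - EYazc p yv a z c) * ((cZA p z astar - cZA p z acirc) / cZA p z a)) ^ 2)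
      + (γ₁ ^ 2 * VZgivenA p zv astar * ∑ c, pC p c / cA p astar c
        + γ₁ ^ 2 * VZgivenA p zv acirc * ∑ c, pC p c / cA p acirc c) := by
  rw [h.phiTD_linear hp hlin, hp.Varp_residual_add yv
    (fun a z => (cZA p z astar - cZA p z acirc) / cZA p z a) _ (h.sum_centered_Z hp zv _),
    h.sum_centered_Z_sq hp, ← sum_mul_ind_sub_sq hne
      (fun a => γ₁ ^ 2 * VZgivenA p zv a * ∑ c, pC p c / cA p a c)]
  congr 1
  refine Finset.sum_congr rfl fun a _ => ?_
  rw [Finset.mul_sum, Finset.mul_sum, Finset.sum_mul]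
  refine Finset.sum_congr rfl fun c _ => ?_
  have hac : pAC p a c = cA p a c * pC p c := by
    rw [cA, div_mul_cancel₀ _ (hp.pC_pos c).ne']
  have hcA := (hp.cA_pos a c).ne'
  rw [hac]
  field_simp

theorem IndepZC.Varp_phiFD_linear (hp : IsPMF p) (h : IndepZC p)
    (hlin : ∀ a z c, EYazc p yv a z c = γ₀ + γ₁ * zv z + γ₂ * cv c + γ₃ * av a)
    {astar acirc : A} (hne : astar ≠ acirc) :
    Varp p (phiFD p yv astar acirc) =
      (∑ c, ∑ a, ∑ z, ∑ y, p c a z y *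
        ((yv y - EYazc p yv a z c) * ((cZA p z astar - cZA p z acirc) / cZA p z a)) ^ 2)
      + ((∑ z, (cZA p z astar - cZA p z acirc) ^ 2
          * ∑ ab, γ₂ ^ 2 * VCgivenA p cv ab * pA p ab / cZA p z ab)
        + (γ₁ ^ 2 * VZgivenA p zv astar * (1 / pA p astar)
          + γ₁ ^ 2 * VZgivenA p zv acirc * (1 / pA p acirc))) := by
  have hC := h.sum_centered_C_sq hp cv
    fun a z => γ₂ * ((cZA p z astar - cZA p z acirc) / cZA p z a)
  have hZ := h.sum_centered_Z_sq hp zv fun a _ => γ₁ * (ind a astar - ind a acirc) / pA p a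
  have hcross := h.sum_centered_C hp cv fun a z =>
    2 * (γ₂ * ((cZA p z astar - cZA p z acirc) / cZA p z a))
      * ((zv z - meanZ p zv a) * (γ₁ * (ind a astar - ind a acirc) / pA p a))
  have hmean : ∑ c, ∑ a, ∑ z, pCAZ p c a z *
      ((cv c - meanC p cv a) * (γ₂ * ((cZA p z astar - cZA p z acirc) / cZA p z a))
        + (zv z - meanZ p zv a) * (γ₁ * (ind a astar - ind a acirc) / pA p a)) = 0 := by
    simp only [mul_add (pCAZ p _ _ _), Finset.sum_add_distrib]
    rw [h.sum_centered_C hp cv fun a z => γ₂ * ((cZA p z astar - cZA p z acirc) / cZA p z a),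
      h.sum_centered_Z hp zv fun a _ => γ₁ * (ind a astar - ind a acirc) / pA p a, add_zero]
  rw [h.phiFD_linear hp hlin, hp.Varp_residual_add yv
    (fun a z => (cZA p z astar - cZA p z acirc) / cZA p z a) _ hmean]
  congr 1
  calc _ = (∑ c, ∑ a, ∑ z, pCAZ p c a z * ((cv c - meanC p cv a)
          * (γ₂ * ((cZA p z astar - cZA p z acirc) / cZA p z a))) ^ 2)
        + (∑ c, ∑ a, ∑ z, pCAZ p c a z * ((zv z - meanZ p zv a)
          * (γ₁ * (ind a astar - ind a acirc) / pA p a)) ^ 2)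
        + ∑ c, ∑ a, ∑ z, pCAZ p c a z * ((cv c - meanC p cv a)
          * (2 * (γ₂ * ((cZA p z astar - cZA p z acirc) / cZA p z a))
            * ((zv z - meanZ p zv a) * (γ₁ * (ind a astar - ind a acirc) / pA p a)))) := by
        simp only [← Finset.sum_add_distrib]
        refine Finset.sum_congr rfl fun c _ => Finset.sum_congr rfl fun a _ =>
          Finset.sum_congr rfl fun z _ => ?_
        ring
    _ = _ := by
        rw [hcross, add_zero, hC, hZ, ← sum_mul_ind_sub_sq hne
          (fun a => γ₁ ^ 2 * VZgivenA p zv a * (1 / pA p a))]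
        congr 1
        · refine Finset.sum_congr rfl fun z _ => ?_
          rw [Finset.mul_sum]
          refine Finset.sum_congr rfl fun a _ => ?_
          have := (hp.cZA_pos z a).ne'
          field_simp
        · refine Finset.sum_congr rfl fun a _ => ?_
          have hpa := (hp.pA_pos a).ne'
          rw [← Finset.sum_mul, ← pA]
          field_simp

end Linear

/-- Difference of the front-door and two-door bounds in a linear model with Z ⊥ C | A. -/
theorem stmt10
    {C A Z Y : Type*} [Fintype C] [Fintype A] [Fintype Z] [Fintype Y]
    [Nonempty C] [Nonempty A] [Nonempty Z] [Nonempty Y] [DecidableEq A]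
    (cv : C → ℝ) (hcv : Function.Injective cv)
    (av : A → ℝ) (hav : Function.Injective av)
    (zv : Z → ℝ) (hzv : Function.Injective zv)
    (p : C → A → Z → Y → ℝ) (yv : Y → ℝ) (hyv : Function.Injective yv)
    (hp : IsPMF p) (astar acirc : A) (hne : astar ≠ acirc)
    (hzc : IndepZC p)
    (γ₀ γ₁ γ₂ γ₃ : ℝ)
    (hlin : ∀ a z c, EYazc p yv a z c = γ₀ + γ₁ * zv z + γ₂ * cv c + γ₃ * av a) :
    Varp p (phiFD p yv astar acirc) - Varp p (phiTD p yv astar acirc) =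
      (∑ z, (cZA p z astar - cZA p z acirc) ^ 2
          * ∑ ab, γ₂ ^ 2 * VCgivenA p cv ab * pA p ab / cZA p z ab)
      + γ₁ ^ 2 * VZgivenA p zv astar * (1 / pA p astar - ∑ c, pC p c / cA p astar c)
      + γ₁ ^ 2 * VZgivenA p zv acirc * (1 / pA p acirc - ∑ c, pC p c / cA p acirc c) := by
  rw [hzc.Varp_phiFD_linear hp hlin hne, hzc.Varp_phiTD_linear hp hlin hne]
  ring

end TwoDoorPaper
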